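/- Let r ≥ 0 be an integer and let X be a real number with X ≠ p. Then F_p(r+2,r+2;X) − F_p(r,r;X) = (X^{r+1}·(X+p)·(X−1)/(X−p)) · ( p^{r+1}(1 − p)(pX + 1) + X^{r+1}(1 + X²)(p − p^{−1}X) ). -/

import Mathlib

/-- The symbol `[u,v]` of Hironaka, for integers `u ≥ v ≥ 0`. -/
noncomputable def bsym (p u v : ℕ) : ℚ :=
  (∏ i ∈ Finset.Icc 1 u, (1 - (-(p : ℚ))⁻¹ ^ i)) /
    ((∏ i ∈ Finset.Icc 1 v, (1 - (-(p : ℚ))⁻¹ ^ i)) *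
      (∏ i ∈ Finset.Icc 1 (u - v), (1 - (-(p : ℚ))⁻¹ ^ i)))

/-- For a pair `a = (a₁, a₂)`, the quantity `a'_i = #{j ∈ {1,2} : a_j ≥ i}`. -/
def dualCt (a : ℕ × ℕ) (i : ℕ) : ℕ :=
  (if i ≤ a.1 then 1 else 0) + (if i ≤ a.2 then 1 else 0)

/-- Hironaka's local factor `I_j(μ, λ)`, for pairs `μ = (c,d)`, `λ = (λ₁,λ₂)`. -/
noncomputable def hirI (p : ℕ) (μ lam : ℕ × ℕ) (j : ℕ) : ℚ :=
  ∑ i ∈ Finset.Icc (dualCt μ (j + 1))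
      (min (dualCt (lam.1 + 1, lam.2 + 1) (j + 1)) (dualCt μ j)),
    (-(p : ℚ)) ^ (i * (2 * dualCt (lam.1 + 1, lam.2 + 1) (j + 1) + 1 - i) / 2) *
      bsym p (dualCt (lam.1 + 1, lam.2 + 1) (j + 1) - dualCt μ (j + 1))
        (dualCt (lam.1 + 1, lam.2 + 1) (j + 1) - i) *
      bsym p (dualCt (lam.1 + 1, lam.2 + 1) j - i)
        (dualCt (lam.1 + 1, lam.2 + 1) j - dualCt μ j)

/-- `ε_n = 0` if `n = 0` and `1` otherwise. -/
def epsn (n : ℕ) : ℕ := if n = 0 then 0 else 1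

/-- The specialization `F_p(a,b;X)` of Hironaka's formula for Hermitian representation
densities: `α(diag(p,1) ⊕ 1_r, diag(p^a, p^b)) = F_p(a,b;(-p)^{-r})`. -/
noncomputable def Fp (p a b : ℕ) (X : ℝ) : ℝ :=
  ∑ c ∈ Finset.range (a + 2), ∑ d ∈ Finset.range (min c (b + 1) + 1),
    (-1 : ℝ) ^ d * ((p : ℝ) ^ (2 * d + c))⁻¹ * X ^ (c + d) *
      (-(p : ℝ)) ^ (epsn c + epsn d) *
      ∏ j ∈ Finset.Icc 1 (a + 1), ((hirI p (c, d) (a, b) j : ℚ) : ℝ)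

theorem dualCt_eq_two {c d j : ℕ} (hc : j ≤ c) (hd : j ≤ d) : dualCt (c, d) j = 2 := by
  simp [dualCt, hc, hd]

theorem dualCt_eq_one {c d j : ℕ} (hc : j ≤ c) (hd : d < j) : dualCt (c, d) j = 1 := by
  simp [dualCt, hc, hd]

theorem dualCt_eq_zero {c d j : ℕ} (hc : c < j) (hd : d < j) : dualCt (c, d) j = 0 := by
  simp [dualCt, hc, hd]

theorem bsym_self {p : ℕ} (hp : 2 ≤ p) (u : ℕ) : bsym p u u = 1 := by
  have h : (∏ i ∈ Finset.Icc 1 u, (1 - (-(p : ℚ))⁻¹ ^ i)) ≠ 0 := by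
    refine Finset.prod_ne_zero_iff.2 fun i hi => sub_ne_zero.2 fun h => ?_
    have h1 : |(-(p : ℚ))⁻¹ ^ i| < 1 := by
      rw [abs_pow, abs_inv, abs_neg, Nat.abs_cast]
      exact pow_lt_one₀ (by positivity) (inv_lt_one_of_one_lt₀ (by exact_mod_cast hp))
        (by have := (Finset.mem_Icc.1 hi).1; omega)
    rw [← h] at h1
    norm_num at h1
  rw [bsym, Nat.sub_self, Finset.Icc_eq_empty_of_lt Nat.zero_lt_one, Finset.prod_empty, mul_one,
    div_self h]

theorem bsym_zero {p : ℕ} (hp : 2 ≤ p) (u : ℕ) : bsym p u 0 = 1 := by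
  have h := bsym_self hp u
  simp only [bsym, Nat.sub_zero, Nat.sub_self, Finset.Icc_eq_empty_of_lt Nat.zero_lt_one,
    Finset.prod_empty, mul_one, one_mul] at h ⊢
  exact h

theorem bsym_two_one {p : ℕ} (hp : 2 ≤ p) : bsym p 2 1 = 1 - (p : ℚ)⁻¹ := by
  have h2 : (2 : ℚ) ≤ p := by exact_mod_cast hp
  have h : (1 : ℚ) - (-(p : ℚ))⁻¹ ≠ 0 := by
    rw [inv_neg, sub_neg_eq_add]; positivity
  have h' : (1 : ℚ) + (p : ℚ)⁻¹ ≠ 0 := by positivity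
  have hs : Finset.Icc 1 2 = ({1, 2} : Finset ℕ) := rfl
  simp only [bsym, hs, Finset.Icc_self, Finset.prod_singleton, Nat.add_one_sub_one, pow_one,
    Finset.prod_pair (show (1 : ℕ) ≠ 2 by decide)]
  rw [div_eq_iff (mul_ne_zero h h), inv_neg]
  ring

section LocalFactor

variable {p c d a j : ℕ}

theorem hirI_two_two (hp : 2 ≤ p) (hc : j + 1 ≤ c) (hd : j + 1 ≤ d) (ha : j ≤ a) :
    hirI p (c, d) (a, a) j = -(p : ℚ) ^ 3 := by
  simp only [hirI]
  rw [dualCt_eq_two hc hd, dualCt_eq_two (by omega : j ≤ c) (by omega),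
    dualCt_eq_two (by omega : j + 1 ≤ a + 1) (by omega),
    dualCt_eq_two (by omega : j ≤ a + 1) (by omega)]
  simp [bsym_self hp]
  ring

theorem hirI_one_one (hp : 2 ≤ p) (hc : j + 1 ≤ c) (hd : d < j) (ha : j ≤ a) :
    hirI p (c, d) (a, a) j = (p : ℚ) ^ 2 := by
  simp only [hirI]
  rw [dualCt_eq_one hc (by omega), dualCt_eq_one (by omega : j ≤ c) hd,
    dualCt_eq_two (by omega : j + 1 ≤ a + 1) (by omega),
    dualCt_eq_two (by omega : j ≤ a + 1) (by omega)]
  simp [bsym_self hp]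

theorem hirI_two_one (hp : 2 ≤ p) (hc : j + 1 ≤ c) (hd : j = d) (ha : j ≤ a) :
    hirI p (c, d) (a, a) j = (p : ℚ) ^ 2 - (p : ℚ) ^ 3 := by
  simp only [hirI]
  rw [dualCt_eq_one hc (by omega), dualCt_eq_two (by omega : j ≤ c) (by omega),
    dualCt_eq_two (by omega : j + 1 ≤ a + 1) (by omega),
    dualCt_eq_two (by omega : j ≤ a + 1) (by omega)]
  simp [Finset.sum_Icc_succ_top, bsym_self hp, bsym_zero hp]
  ring

theorem hirI_zero (hp : 2 ≤ p) (hc : c < j) (hd : d < j) (ha : j ≤ a + 1) :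
    hirI p (c, d) (a, a) j = 1 := by
  simp only [hirI]
  rw [dualCt_eq_zero (by omega : c < j + 1) (by omega), dualCt_eq_zero hc hd,
    dualCt_eq_two (by omega : j ≤ a + 1) (by omega)]
  simp [bsym_self hp]

theorem hirI_one_zero (hp : 2 ≤ p) (hc : j = c) (hd : d < j) (ha : j ≤ a) :
    hirI p (c, d) (a, a) j = (1 + (p : ℚ) ^ 2) * (1 - (p : ℚ)⁻¹) := by
  simp only [hirI]
  rw [dualCt_eq_zero (by omega : c < j + 1) (by omega), dualCt_eq_one (by omega : j ≤ c) hd,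
    dualCt_eq_two (by omega : j + 1 ≤ a + 1) (by omega),
    dualCt_eq_two (by omega : j ≤ a + 1) (by omega)]
  simp [Finset.sum_Icc_succ_top, bsym_self hp, bsym_two_one hp]
  ring

theorem hirI_two_zero (hp : 2 ≤ p) (hc : j = c) (hd : j = d) (ha : j ≤ a) :
    hirI p (c, d) (a, a) j = (1 - (p : ℚ)) * (1 + (p : ℚ) ^ 2) := by
  have h0 : (p : ℚ) ≠ 0 := by positivity
  simp only [hirI]
  rw [dualCt_eq_zero (by omega : c < j + 1) (by omega), dualCt_eq_two (by omega : j ≤ c) (by omega),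
    dualCt_eq_two (by omega : j + 1 ≤ a + 1) (by omega),
    dualCt_eq_two (by omega : j ≤ a + 1) (by omega)]
  simp [Finset.sum_Icc_succ_top, bsym_self hp, bsym_zero hp, bsym_two_one hp]
  field_simp
  ring

theorem hirI_last_one (hp : 2 ≤ p) (hc : j = c) (hd : d < j) (ha : j = a + 1) :
    hirI p (c, d) (a, a) j = 1 - (p : ℚ)⁻¹ := by
  simp only [hirI]
  rw [dualCt_eq_zero (by omega : c < j + 1) (by omega), dualCt_eq_one (by omega : j ≤ c) hd,
    dualCt_eq_zero (by omega : a + 1 < j + 1) (by omega),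
    dualCt_eq_two (by omega : j ≤ a + 1) (by omega)]
  simp [bsym_self hp, bsym_two_one hp]

theorem hirI_last_two (hp : 2 ≤ p) (hc : j = c) (hd : j = d) (ha : j = a + 1) :
    hirI p (c, d) (a, a) j = 1 := by
  simp only [hirI]
  rw [dualCt_eq_zero (by omega : c < j + 1) (by omega), dualCt_eq_two (by omega : j ≤ c) (by omega),
    dualCt_eq_zero (by omega : a + 1 < j + 1) (by omega),
    dualCt_eq_two (by omega : j ≤ a + 1) (by omega)]
  simp [bsym_self hp, bsym_zero hp]

end LocalFactor

theorem prod_Icc_eq_prod_range {M : Type*} [CommMonoid M] {f : ℕ → M} {c n : ℕ} (hcn : c ≤ n)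
    (h : ∀ j, c < j → j ≤ n → f j = 1) :
    ∏ j ∈ Finset.Icc 1 n, f j = ∏ j ∈ Finset.range c, f (j + 1) := by
  rw [Finset.range_eq_Ico, Finset.prod_Ico_add' f 0 c 1]
  symm
  apply Finset.prod_subset
  · intro j; simp only [Finset.mem_Ico, Finset.mem_Icc]; omega
  · intro j hj hj'
    simp only [Finset.mem_Ico, Finset.mem_Icc] at hj hj'
    exact h j (by omega) (by omega)

/-- The product of the local factors for `μ = (k + 1, 0)`, where `e` is the factor at `k + 1`. -/
theorem prod_hirI_row {p k a : ℕ} (hp : 2 ≤ p) (hk : k ≤ a) {e : ℚ}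
    (he : hirI p (k + 1, 0) (a, a) (k + 1) = e) :
    ∏ j ∈ Finset.Icc 1 (a + 1), hirI p (k + 1, 0) (a, a) j = ((p : ℚ) ^ 2) ^ k * e := by
  rw [prod_Icc_eq_prod_range (by omega : k + 1 ≤ a + 1)
    fun j h1 h2 => hirI_zero hp h1 (by omega) h2, Finset.prod_range_succ, he]
  congr 1
  rw [Finset.prod_congr rfl fun j hj => ?_, Finset.prod_const, Finset.card_range]
  have := Finset.mem_range.1 hj
  exact hirI_one_one hp (by omega) (by omega) (by omega)

/-- The product of the local factors for `μ = (k + 1, k + 1)`, where `e` is the factor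
at `k + 1`. -/
theorem prod_hirI_diag {p k a : ℕ} (hp : 2 ≤ p) (hk : k ≤ a) {e : ℚ}
    (he : hirI p (k + 1, k + 1) (a, a) (k + 1) = e) :
    ∏ j ∈ Finset.Icc 1 (a + 1), hirI p (k + 1, k + 1) (a, a) j = (-(p : ℚ) ^ 3) ^ k * e := by
  rw [prod_Icc_eq_prod_range (by omega : k + 1 ≤ a + 1)
    fun j h1 h2 => hirI_zero hp h1 h1 h2, Finset.prod_range_succ, he]
  congr 1
  rw [Finset.prod_congr rfl fun j hj => ?_, Finset.prod_const, Finset.card_range]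
  have := Finset.mem_range.1 hj
  exact hirI_two_two hp (by omega) (by omega) (by omega)

/-- The product of the local factors for `μ = (d + m + 2, d + 1)`, where `e` is the factor
at `d + m + 2`. -/
theorem prod_hirI_mid {p d m a : ℕ} (hp : 2 ≤ p) (hk : d + 1 + m ≤ a) {e : ℚ}
    (he : hirI p (d + 1 + m + 1, d + 1) (a, a) (d + 1 + m + 1) = e) :
    ∏ j ∈ Finset.Icc 1 (a + 1), hirI p (d + 1 + m + 1, d + 1) (a, a) j =
      (-(p : ℚ) ^ 3) ^ d * ((p : ℚ) ^ 2 - (p : ℚ) ^ 3) * ((p : ℚ) ^ 2) ^ m * e := by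
  rw [prod_Icc_eq_prod_range (by omega : d + 1 + m + 1 ≤ a + 1)
    fun j h1 h2 => hirI_zero hp h1 (by omega) h2, Finset.prod_range_succ, he,
    Finset.prod_range_add, Finset.prod_range_succ]
  congr 1
  congr 1
  · congr 1
    · rw [Finset.prod_congr rfl fun j hj => ?_, Finset.prod_const, Finset.card_range]
      have := Finset.mem_range.1 hj
      exact hirI_two_two hp (by omega) (by omega) (by omega)
    · exact hirI_two_one hp (by omega) rfl (by omega)
  · rw [Finset.prod_congr rfl fun j hj => ?_, Finset.prod_const, Finset.card_range]
    have := Finset.mem_range.1 hj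
    exact hirI_one_one hp (by omega) (by omega) (by omega)

/-- The sum over `d` of the terms of `Fp p a a X` with `c = k + 1`, where `e₁` and `e₂` are the
local factors at `j = k + 1` for `d < c` and for `d = c`. -/
theorem sum_terms_eq {p k a : ℕ} (hp : 2 ≤ p) (hk : k ≤ a) {X : ℝ} (hX : X ≠ p) {e₁ e₂ : ℚ}
    (h₁ : ∀ d ≤ k, hirI p (k + 1, d) (a, a) (k + 1) = e₁)
    (h₂ : hirI p (k + 1, k + 1) (a, a) (k + 1) = e₂) :
    ∑ d ∈ Finset.range (k + 1 + 1),
      (-1 : ℝ) ^ d * ((p : ℝ) ^ (2 * d + (k + 1)))⁻¹ * X ^ (k + 1 + d) *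
        (-(p : ℝ)) ^ (epsn (k + 1) + epsn d) *
        ∏ j ∈ Finset.Icc 1 (a + 1), ((hirI p (k + 1, d) (a, a) j : ℚ) : ℝ) =
      -(1 - p) * e₁ * X ^ (k + 1) * ((X ^ (k + 1) - (p : ℝ) ^ (k + 1)) / (X - p))
        - e₁ * (p : ℝ) ^ (k + 1) * X ^ (k + 1) - e₂ * X ^ (2 * (k + 1)) / p := by
  have h0 : (p : ℝ) ≠ 0 := by positivity
  have hs : (-1 : ℝ) ^ k * (-1) ^ k = 1 := by rw [← mul_pow]; norm_num
  have hg : (X ^ (k + 1) - (p : ℝ) ^ (k + 1)) / (X - p) =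
      (∑ d ∈ Finset.range k, X ^ (d + 1) * (p : ℝ) ^ (k - (d + 1))) + (p : ℝ) ^ k := by
    rw [div_eq_iff (sub_ne_zero.2 hX), ← geom_sum₂_mul, Finset.sum_range_succ']
    simp
  rw [hg, Finset.sum_range_succ, Finset.sum_range_succ']
  simp only [← Rat.cast_prod]
  rw [prod_hirI_row hp hk (h₁ 0 (Nat.zero_le k)), prod_hirI_diag hp hk h₂]
  have hm : ∀ d ∈ Finset.range k,
      (-1 : ℝ) ^ (d + 1) * ((p : ℝ) ^ (2 * (d + 1) + (k + 1)))⁻¹ * X ^ (k + 1 + (d + 1)) *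
        (-(p : ℝ)) ^ (epsn (k + 1) + epsn (d + 1)) *
        ((∏ j ∈ Finset.Icc 1 (a + 1), hirI p (k + 1, d + 1) (a, a) j : ℚ) : ℝ) =
      -(1 - p) * e₁ * X ^ (k + 1) * (X ^ (d + 1) * (p : ℝ) ^ (k - (d + 1))) := by
    intro d hd
    have hdk : d + 1 ≤ k := Finset.mem_range.1 hd
    obtain ⟨m, rfl⟩ := Nat.exists_eq_add_of_le hdk
    have hsd : (-1 : ℝ) ^ d * (-1) ^ d = 1 := by rw [← mul_pow]; norm_num
    rw [prod_hirI_mid hp hk (h₁ (d + 1) (by omega)), Nat.add_sub_cancel_left]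
    push_cast
    rw [neg_pow ((p : ℝ) ^ 3)]
    simp only [epsn, Nat.add_eq_zero_iff, one_ne_zero, and_false, if_false]
    field_simp
    linear_combination (-(X ^ (d + 1 + m + 1 + (d + 1))) * e₁ * (1 - p) *
      (p : ℝ) ^ (2 * (d + 1) + (d + 1 + m + 1) + m)) * hsd
  rw [Finset.sum_congr rfl hm, ← Finset.mul_sum]
  push_cast
  rw [neg_pow ((p : ℝ) ^ 3)]
  simp only [epsn, Nat.add_eq_zero_iff, one_ne_zero, and_false, if_false, if_true]
  generalize ∑ d ∈ Finset.range k, X ^ (d + 1) * (p : ℝ) ^ (k - (d + 1)) = S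
  field_simp
  linear_combination (-((p : ℝ) ^ (4 * (k + 1)) * X ^ (2 * (k + 1)) * e₂)) * hs

/-- `Fp p a a X` as the sum of the contributions of `c = 0`, of `1 ≤ c ≤ a`, and of
`c = a + 1`. -/
theorem Fp_diag_eq {p : ℕ} (hp : 2 ≤ p) (a : ℕ) {X : ℝ} (hX : X ≠ p) :
    Fp p a a X = 1 + (∑ k ∈ Finset.range a,
      (-(1 - p) * ((1 + (p : ℝ) ^ 2) * (1 - (p : ℝ)⁻¹)) * X ^ (k + 1) *
          ((X ^ (k + 1) - (p : ℝ) ^ (k + 1)) / (X - p))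
        - (1 + (p : ℝ) ^ 2) * (1 - (p : ℝ)⁻¹) * (p : ℝ) ^ (k + 1) * X ^ (k + 1)
        - (1 - (p : ℝ)) * (1 + (p : ℝ) ^ 2) * X ^ (2 * (k + 1)) / p)) +
      (-(1 - p) * (1 - (p : ℝ)⁻¹) * X ^ (a + 1) *
          ((X ^ (a + 1) - (p : ℝ) ^ (a + 1)) / (X - p))
        - (1 - (p : ℝ)⁻¹) * (p : ℝ) ^ (a + 1) * X ^ (a + 1) - X ^ (2 * (a + 1)) / p) := by
  have hmin : ∀ c ∈ Finset.range (a + 2), min c (a + 1) = c := fun c hc =>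
    min_eq_left (Nat.le_of_lt_succ (Finset.mem_range.1 hc))
  rw [Fp, Finset.sum_congr rfl fun c hc => by rw [hmin c hc], Finset.sum_range_succ,
    Finset.sum_range_succ', add_comm (Finset.sum (Finset.range a) _) _]
  congr 1
  · congr 1
    · have h : ∏ j ∈ Finset.Icc 1 (a + 1), ((hirI p (0, 0) (a, a) j : ℚ) : ℝ) = 1 :=
        Finset.prod_eq_one fun j hj => by
          have := Finset.mem_Icc.1 hj
          rw [hirI_zero hp (by omega) (by omega) this.2, Rat.cast_one]
      simp [epsn, h]
    · refine Finset.sum_congr rfl fun k hk => ?_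
      have hk := Finset.mem_range.1 hk
      rw [sum_terms_eq hp hk.le hX (fun d hd => hirI_one_zero hp rfl (by omega) hk)
        (hirI_two_zero hp rfl rfl hk)]
      push_cast
      ring
  · rw [sum_terms_eq hp le_rfl hX (fun d hd => hirI_last_one hp rfl (by omega) rfl)
      (hirI_last_two hp rfl rfl rfl)]
    push_cast
    ring

theorem statement17 (p : ℕ) (hp : p.Prime) (hodd : Odd p)
    (r : ℕ) (X : ℝ) (hX : X ≠ (p : ℝ)) :
    Fp p (r + 2) (r + 2) X - Fp p r r X
      = (X ^ (r + 1) * (X + p) * (X - 1) / (X - p)) *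
          ((p : ℝ) ^ (r + 1) * (1 - p) * ((p : ℝ) * X + 1)
            + X ^ (r + 1) * (1 + X ^ 2) * ((p : ℝ) - (p : ℝ)⁻¹ * X)) := by
  have h0 : (p : ℝ) ≠ 0 := by exact_mod_cast hp.ne_zero
  have h1 : X - p ≠ 0 := sub_ne_zero.2 hX
  rw [Fp_diag_eq hp.two_le _ hX, Fp_diag_eq hp.two_le _ hX, Finset.sum_range_succ,
    Finset.sum_range_succ]
  generalize Finset.sum (M := ℝ) (Finset.range r) _ = S
  field_simp
  ring
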